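/- With ř(i,j,k,n) counting colored quarter-plane walks by steps starting on the x-axis as defined below, let Ř = Σ ř(i,j,k,n) x^i y^j v^k z^n ∈ ℤ[[x,y,v,z]], and let Ř^y = Σ_{j,k,n} ř(0,j,k,n) y^j v^k z^n, Ř^x = Σ_{i,k,n} ř(i,0,k,n) x^i v^k z^n, Ř^0 = Σ_{k,n} ř(0,0,k,n) v^k z^n, all viewed in ℤ[[x,y,v,z]]. Then: (1) the functional equation (xy − z(y+x²)(1+y))·Ř = xy − zy(1+y)·Ř^y + z(y² − x² + (v−1)y(x²+1+2y))·Ř^x − zy(y + (v−1)(1+2y))·Ř^0 holds in ℤ[[x,y,v,z]]; and (2) for all n, k ≥ 0, the number of Dyck paths P ∈ 𝒟_n with sv(P) = k equals Σ_i ř(i,0,k,n). -/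

import Mathlib

/-- Steps of a colored quarter-plane walk: `E = (1,0)`, `W = (−1,0)`, `SE = (1,−1)`, and
two colors `NW1`, `NW2` of the step `NW = (−1,1)` (the second color is only allowed when
the step starts on the x-axis; elsewhere `NW` steps are "uncolored", i.e. of color `NW1`). -/
inductive QStep : Type
  | E | W | NW1 | NW2 | SE
  deriving DecidableEq

/-- The x-coordinate of the walk `w` after `j` steps. -/
def xpos (w : List QStep) (j : ℕ) : ℤ :=
  ((w.take j).count QStep.E : ℤ) + ((w.take j).count QStep.SE : ℤ)
    - ((w.take j).count QStep.W : ℤ) - ((w.take j).count QStep.NW1 : ℤ)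
    - ((w.take j).count QStep.NW2 : ℤ)

/-- The y-coordinate of the walk `w` after `j` steps. -/
def ypos (w : List QStep) (j : ℕ) : ℤ :=
  ((w.take j).count QStep.NW1 : ℤ) + ((w.take j).count QStep.NW2 : ℤ)
    - ((w.take j).count QStep.SE : ℤ)

/-- A colored quarter-plane walk: it starts at the origin, stays in the first quadrant, and
the second color `NW2` may only be used for `NW` steps starting at height `0`. -/
def IsColoredQWalk (w : List QStep) : Prop :=
  (∀ j, 0 ≤ xpos w j ∧ 0 ≤ ypos w j) ∧
    ∀ i < w.length, w.getD i QStep.E = QStep.NW2 → ypos w i = 0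

/-- The number of steps of `w` starting at a point with second coordinate `0`. -/
def axisStartSteps (w : List QStep) : ℕ :=
  ((Finset.range w.length).filter fun i => ypos w i = 0).card

/-- `rv i j k n`: the number of colored quarter-plane walks of length `n` ending at `(i,j)`
with exactly `k` steps starting at a point with second coordinate `0`. -/
noncomputable def rv (i j k n : ℕ) : ℕ :=
  {w : List QStep | IsColoredQWalk w ∧ w.length = n ∧
    xpos w n = i ∧ ypos w n = j ∧ axisStartSteps w = k}.ncard

/-- `Ř = Σ ř(i,j,k,n) x^i y^j v^k z^n ∈ ℤ[[x,y,v,z]]`.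
Variables: `0 = x`, `1 = y`, `2 = v`, `3 = z`. -/
noncomputable def Rv : MvPowerSeries (Fin 4) ℤ := fun d =>
  (rv (d 0) (d 1) (d 2) (d 3) : ℤ)

/-- `Ř^y = Σ_{j,k,n} ř(0,j,k,n) y^j v^k z^n`, viewed in `ℤ[[x,y,v,z]]`. -/
noncomputable def Rvy : MvPowerSeries (Fin 4) ℤ := fun d =>
  if d 0 = 0 then (rv 0 (d 1) (d 2) (d 3) : ℤ) else 0

/-- `Ř^x = Σ_{i,k,n} ř(i,0,k,n) x^i v^k z^n`, viewed in `ℤ[[x,y,v,z]]`. -/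
noncomputable def Rvx : MvPowerSeries (Fin 4) ℤ := fun d =>
  if d 1 = 0 then (rv (d 0) 0 (d 2) (d 3) : ℤ) else 0

/-- `Ř^0 = Σ_{k,n} ř(0,0,k,n) v^k z^n`, viewed in `ℤ[[x,y,v,z]]`. -/
noncomputable def Rv0 : MvPowerSeries (Fin 4) ℤ := fun d =>
  if d 0 = 0 ∧ d 1 = 0 then (rv 0 0 (d 2) (d 3) : ℤ) else 0

/-- The height of the lattice path encoded by `w` (with `true = U`, `false = D`) after `j` steps. -/
def ht (w : List Bool) (j : ℕ) : ℤ :=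
  ((w.take j).count true : ℤ) - ((w.take j).count false : ℤ)

/-- A Dyck path of semilength `n`: a grand Dyck path that never goes below the x-axis. -/
def IsDyck (n : ℕ) (w : List Bool) : Prop :=
  w.length = 2 * n ∧ w.count true = n ∧ ∀ j, 0 ≤ ht w j

/-- The number of symmetric vertices of a Dyck path of semilength `n`:
`sv(P) = #{i ∈ {0,…,n−1} : h_i = h_{2n−i}}`. -/
def svGD (n : ℕ) (w : List Bool) : ℕ :=
  ((Finset.range n).filter fun i => ht w i = ht w (2 * n - i)).card


/-- Splitting a set of words of length `n+1` by the last letter. -/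
lemma ncard_snoc {α : Type} [Fintype α] (n : ℕ) (S : Set (List α))
    (hS : ∀ w ∈ S, w.length = n + 1) : S.ncard = ∑ s, {w | w ++ [s] ∈ S}.ncard := by
  have hfin : ∀ s, ({w | w ++ [s] ∈ S} : Set (List α)).Finite := fun s =>
    (List.finite_length_eq α n).subset (fun w hw => by simpa using hS _ hw)
  have : ∀ s, Finite ({w | w ++ [s] ∈ S} : Set (List α)) := fun s => (hfin s).to_subtype
  let f : (Σ s, ({w | w ++ [s] ∈ S} : Set (List α))) → S := fun p => ⟨p.2.1 ++ [p.1], p.2.2⟩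
  have hf : Function.Bijective f := by
    constructor
    · rintro ⟨s, w, hw⟩ ⟨t, u, hu⟩ h
      have h' : w ++ [s] = u ++ [t] := congrArg Subtype.val h
      obtain ⟨h1, h2⟩ := List.append_inj' h' rfl
      obtain rfl : s = t := by simpa using h2
      subst h1
      rfl
    · rintro ⟨w, hw⟩
      have hne : w ≠ [] := by
        rintro rfl
        simpa using hS _ hw
      refine ⟨⟨w.getLast hne, w.dropLast, ?_⟩, ?_⟩
      · simpa [List.dropLast_append_getLast] using hw
      · simp [f, List.dropLast_append_getLast]
  rw [← Nat.card_coe_set_eq, ← Nat.card_congr (Equiv.ofBijective f hf), Nat.card_sigma]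
  simp only [Nat.card_coe_set_eq]

lemma take_snoc_le {α : Type} (w : List α) (s : α) (j : ℕ) (h : j ≤ w.length) :
    (w ++ [s]).take j = w.take j := by
  rw [List.take_append_of_le_length h]

lemma take_snoc_gt {α : Type} (w : List α) (s : α) (j : ℕ) (h : w.length < j) :
    (w ++ [s]).take j = w ++ [s] := by
  apply List.take_of_length_le
  simp; omega

/-- Horizontal displacement. -/
def dxs : QStep → ℤ
  | .E => 1 | .W => -1 | .NW1 => -1 | .NW2 => -1 | .SE => 1

/-- Vertical displacement. -/
def dys : QStep → ℤ
  | .E => 0 | .W => 0 | .NW1 => 1 | .NW2 => 1 | .SE => -1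

instance : Fintype QStep :=
  ⟨{.E, .W, .NW1, .NW2, .SE}, fun x => by cases x <;> simp⟩

lemma sum_QStep (f : QStep → ℕ) : ∑ s, f s = f .E + f .W + f .NW1 + f .NW2 + f .SE := by
  have : (Finset.univ : Finset QStep) = {.E, .W, .NW1, .NW2, .SE} := rfl
  rw [this]
  simp; ring

lemma xpos_le (w : List QStep) (s : QStep) (j : ℕ) (h : j ≤ w.length) :
    xpos (w ++ [s]) j = xpos w j := by simp only [xpos, take_snoc_le w s j h]
lemma ypos_le (w : List QStep) (s : QStep) (j : ℕ) (h : j ≤ w.length) :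
    ypos (w ++ [s]) j = ypos w j := by simp only [ypos, take_snoc_le w s j h]
lemma xpos_gt (w : List QStep) (s : QStep) (j : ℕ) (h : w.length < j) :
    xpos (w ++ [s]) j = xpos w w.length + dxs s := by
  simp only [xpos, take_snoc_gt w s j h, List.take_length, List.count_append]
  cases s <;> simp [dxs] <;> ring
lemma ypos_gt (w : List QStep) (s : QStep) (j : ℕ) (h : w.length < j) :
    ypos (w ++ [s]) j = ypos w w.length + dys s := by
  simp only [ypos, take_snoc_gt w s j h, List.take_length, List.count_append]
  cases s <;> simp [dys] <;> ring

lemma xpos_big (w : List QStep) (j : ℕ) (h : w.length ≤ j) : xpos w j = xpos w w.length := by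
  simp [xpos, List.take_of_length_le h]
lemma ypos_big (w : List QStep) (j : ℕ) (h : w.length ≤ j) : ypos w j = ypos w w.length := by
  simp [ypos, List.take_of_length_le h]

lemma walk_snoc (w : List QStep) (s : QStep) : IsColoredQWalk (w ++ [s]) ↔
    IsColoredQWalk w ∧ (0 ≤ xpos w w.length + dxs s ∧ 0 ≤ ypos w w.length + dys s) ∧
      (s = .NW2 → ypos w w.length = 0) := by
  constructor
  · rintro ⟨h1, h2⟩
    refine ⟨⟨fun j => ?_, fun i hi h => ?_⟩, ?_, fun h => ?_⟩
    · rcases le_total j w.length with hj | hj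
      · simpa only [xpos_le w s j hj, ypos_le w s j hj] using h1 j
      · rw [xpos_big w j hj, ypos_big w j hj]
        simpa only [xpos_le w s _ le_rfl, ypos_le w s _ le_rfl] using h1 w.length
    · have := h2 i (by simp; omega) (by rw [List.getD_append _ _ _ _ hi]; exact h)
      rwa [ypos_le w s i hi.le] at this
    · have := h1 (w.length + 1)
      rwa [xpos_gt w s _ (by omega), ypos_gt w s _ (by omega)] at this
    · have := h2 w.length (by simp) (by simpa using h)
      rwa [ypos_le w s _ le_rfl] at this
  · rintro ⟨⟨h1, h2⟩, h3, h4⟩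
    refine ⟨fun j => ?_, fun i hi h => ?_⟩
    · rcases le_or_gt j w.length with hj | hj
      · simpa only [xpos_le w s j hj, ypos_le w s j hj] using h1 j
      · rwa [xpos_gt w s j hj, ypos_gt w s j hj]
    · rcases lt_or_ge i w.length with hi' | hi'
      · rw [ypos_le w s i hi'.le]
        rw [List.getD_append _ _ _ _ hi'] at h
        exact h2 i hi' h
      · obtain rfl : i = w.length := by simp at hi; omega
        rw [ypos_le w s _ le_rfl]
        exact h4 (by simpa using h)

lemma axis_snoc (w : List QStep) (s : QStep) : axisStartSteps (w ++ [s]) =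
    axisStartSteps w + if ypos w w.length = 0 then 1 else 0 := by
  unfold axisStartSteps
  rw [Finset.card_filter, Finset.card_filter, List.length_append, List.length_singleton,
    Finset.sum_range_succ, ypos_le w s _ le_rfl]
  congr 1
  apply Finset.sum_congr rfl
  intro i hi
  rw [ypos_le w s i (Finset.mem_range.1 hi).le]

/-- Integer-indexed walk count. -/
noncomputable def cC (n : ℕ) (i j k : ℤ) : ℕ :=
  {w : List QStep | IsColoredQWalk w ∧ w.length = n ∧
    xpos w n = i ∧ ypos w n = j ∧ (axisStartSteps w : ℤ) = k}.ncard

lemma rv_eq (i j k n : ℕ) : rv i j k n = cC n i j k := by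
  simp [rv, cC]

lemma cC_neg (n : ℕ) (i j k : ℤ) (h : i < 0 ∨ j < 0 ∨ k < 0) : cC n i j k = 0 := by
  unfold cC
  convert Set.ncard_empty (List QStep)
  ext w
  simp only [Set.mem_ofPred_eq, Set.mem_empty_iff_false, iff_false]
  rintro ⟨⟨h1, -⟩, h2, h3, h4, h5⟩
  have := h1 n
  omega

lemma cC_zero (i j k : ℤ) : cC 0 i j k = if i = 0 ∧ j = 0 ∧ k = 0 then 1 else 0 := by
  unfold cC
  split_ifs with h
  · obtain ⟨rfl, rfl, rfl⟩ := h
    convert Set.ncard_singleton ([] : List QStep)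
    ext w
    simp only [Set.mem_ofPred_eq, Set.mem_singleton_iff]
    constructor
    · rintro ⟨-, h, -⟩
      exact List.length_eq_zero_iff.1 h
    · rintro rfl
      simp [IsColoredQWalk, xpos, ypos, axisStartSteps]
  · convert Set.ncard_empty (List QStep)
    ext w
    simp only [Set.mem_ofPred_eq, Set.mem_empty_iff_false, iff_false]
    rintro ⟨-, h1, h2, h3, h4⟩
    obtain rfl := List.length_eq_zero_iff.1 h1
    simp [xpos, ypos, axisStartSteps] at h2 h3 h4
    omega

lemma cC_step (n : ℕ) (i j k : ℤ) (hi : 0 ≤ i) (hj : 0 ≤ j) (s : QStep) :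
    {w | w ++ [s] ∈ {w : List QStep | IsColoredQWalk w ∧ w.length = n + 1 ∧
    xpos w (n+1) = i ∧ ypos w (n+1) = j ∧ (axisStartSteps w : ℤ) = k}}.ncard =
    if s = .NW2 → j = 1 then
      cC n (i - dxs s) (j - dys s) (k - if j - dys s = 0 then 1 else 0) else 0 := by
  have key : ∀ w : List QStep, w ++ [s] ∈ {w : List QStep | IsColoredQWalk w ∧ w.length = n + 1 ∧
    xpos w (n+1) = i ∧ ypos w (n+1) = j ∧ (axisStartSteps w : ℤ) = k} ↔
    (s = .NW2 → j = 1) ∧ IsColoredQWalk w ∧ w.length = n ∧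
    xpos w n = i - dxs s ∧ ypos w n = j - dys s ∧ (axisStartSteps w : ℤ) =
      (k - if j - dys s = 0 then 1 else 0) := by
    intro w
    simp only [Set.mem_ofPred_eq, walk_snoc, axis_snoc, List.length_append, List.length_singleton]
    by_cases hn : w.length = n
    · subst hn
      rw [xpos_gt w s _ (by omega), ypos_gt w s _ (by omega)]
      constructor
      · rintro ⟨⟨h1, h2, h3⟩, -, h4, h5, h6⟩
        have h5' : j - dys s = ypos w w.length := by omega
        refine ⟨fun h => ?_, h1, rfl, by omega, by omega, ?_⟩
        · have := h3 h
          subst h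
          simp [dys] at h5
          omega
        · rw [h5']
          push_cast at h6
          omega
      · rintro ⟨h0, h1, -, h4, h5, h6⟩
        refine ⟨⟨h1, by omega, fun h => ?_⟩, rfl, by omega, by omega, ?_⟩
        · have := h0 h
          subst h
          simp [dys] at h5
          omega
        · rw [h5]
          push_cast
          omega
    · constructor
      · rintro ⟨-, h, -⟩
        omega
      · rintro ⟨-, -, h, -⟩
        omega
  simp only [key]
  by_cases h : (s = .NW2 → j = 1)
  · rw [if_pos h]
    simp only [eq_true h, cC, true_and]
  · simp only [h, if_false, false_and]
    exact Set.ncard_empty _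

lemma cC_succ (n : ℕ) (i j k : ℤ) (hi : 0 ≤ i) (hj : 0 ≤ j) :
    cC (n + 1) i j k =
      cC n (i - 1) j (k - if j = 0 then 1 else 0) + cC n (i + 1) j (k - if j = 0 then 1 else 0)
      + cC n (i + 1) (j - 1) (k - if j = 1 then 1 else 0)
      + (if j = 1 then cC n (i + 1) 0 (k - 1) else 0) + cC n (i - 1) (j + 1) k := by
  conv_lhs => unfold cC
  rw [ncard_snoc n _ (fun w hw => hw.2.1)]
  rw [Finset.sum_congr rfl (fun s _ => cC_step n i j k hi hj s), sum_QStep]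
  have h1 : j - 1 = 0 ↔ j = 1 := by omega
  have h2 : j + 1 ≠ 0 := by omega
  simp only [dxs, dys, reduceCtorEq, false_imp_iff, true_imp_iff, if_true, sub_neg_eq_add, sub_zero, h1,
    h2, if_false]
  by_cases h : j = 1 <;> simp [h]

/-- Height change. -/
def eb (b : Bool) : ℤ := if b then 1 else -1

lemma ht_le (w : List Bool) (s : Bool) (j : ℕ) (h : j ≤ w.length) :
    ht (w ++ [s]) j = ht w j := by simp only [ht, take_snoc_le w s j h]
lemma ht_gt (w : List Bool) (s : Bool) (j : ℕ) (h : w.length < j) :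
    ht (w ++ [s]) j = ht w w.length + eb s := by
  simp only [ht, take_snoc_gt w s j h, List.take_length, List.count_append]
  cases s <;> simp [eb] <;> ring
lemma ht_big (w : List Bool) (j : ℕ) (h : w.length ≤ j) : ht w j = ht w w.length := by
  simp [ht, List.take_of_length_le h]

lemma nonneg_snoc (w : List Bool) (s : Bool) : (∀ j, 0 ≤ ht (w ++ [s]) j) ↔
    (∀ j, 0 ≤ ht w j) ∧ 0 ≤ ht w w.length + eb s := by
  constructor
  · intro h
    refine ⟨fun j => ?_, ?_⟩
    · rcases le_total j w.length with hj | hj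
      · simpa only [ht_le w s j hj] using h j
      · rw [ht_big w j hj]
        simpa only [ht_le w s _ le_rfl] using h w.length
    · have := h (w.length + 1)
      rwa [ht_gt w s _ (by omega)] at this
  · rintro ⟨h1, h2⟩ j
    rcases le_or_gt j w.length with hj | hj
    · simpa only [ht_le w s j hj] using h1 j
    · rwa [ht_gt w s j hj]

/-- Number of meetings of two paths. -/
def meet (n : ℕ) (l r : List Bool) : ℕ := ((Finset.range n).filter fun i => ht l i = ht r i).card

lemma meet_snoc (n : ℕ) (l r : List Bool) (s t : Bool) (hl : l.length = n) (hr : r.length = n) :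
    meet (n + 1) (l ++ [s]) (r ++ [t]) = meet n l r + if ht l n = ht r n then 1 else 0 := by
  unfold meet
  rw [Finset.card_filter, Finset.card_filter, Finset.sum_range_succ, ht_le l s _ hl.ge,
    ht_le r t _ hr.ge]
  congr 1
  apply Finset.sum_congr rfl
  intro i hi
  have := Finset.mem_range.1 hi
  rw [ht_le l s i (by omega), ht_le r t i (by omega)]

/-- Set of pairs of nonnegative paths. -/
def sD (n : ℕ) (a b k : ℤ) : Set (List (Bool × Bool)) :=
  {p | p.length = n ∧ (∀ j, 0 ≤ ht (p.map Prod.fst) j) ∧ (∀ j, 0 ≤ ht (p.map Prod.snd) j) ∧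
    ht (p.map Prod.fst) n = a ∧ ht (p.map Prod.snd) n = b ∧
    (meet n (p.map Prod.fst) (p.map Prod.snd) : ℤ) = k}

/-- Count of pairs of nonnegative paths. -/
noncomputable def cD (n : ℕ) (a b k : ℤ) : ℕ := (sD n a b k).ncard

lemma cD_neg (n : ℕ) (a b k : ℤ) (h : a < 0 ∨ b < 0) : cD n a b k = 0 := by
  unfold cD
  convert Set.ncard_empty (List (Bool × Bool))
  ext p
  simp only [sD, Set.mem_ofPred_eq, Set.mem_empty_iff_false, iff_false]
  rintro ⟨-, h1, h2, h3, h4, -⟩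
  have := h1 n
  have := h2 n
  omega

lemma cD_zero (a b k : ℤ) : cD 0 a b k = if a = 0 ∧ b = 0 ∧ k = 0 then 1 else 0 := by
  unfold cD
  split_ifs with h
  · obtain ⟨rfl, rfl, rfl⟩ := h
    convert Set.ncard_singleton ([] : List (Bool × Bool))
    ext w
    simp only [sD, Set.mem_ofPred_eq, Set.mem_singleton_iff]
    constructor
    · rintro ⟨h, -⟩
      exact List.length_eq_zero_iff.1 h
    · rintro rfl
      simp [ht, meet]
  · convert Set.ncard_empty (List (Bool × Bool))
    ext w
    simp only [sD, Set.mem_ofPred_eq, Set.mem_empty_iff_false, iff_false]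
    rintro ⟨h1, -, -, h2, h3, h4⟩
    obtain rfl := List.length_eq_zero_iff.1 h1
    simp [ht, meet] at h2 h3 h4
    omega

lemma sD_snoc (n : ℕ) (a b k : ℤ) (ha : 0 ≤ a) (hb : 0 ≤ b) (s : Bool × Bool) :
    {p | p ++ [s] ∈ sD (n + 1) a b k} =
      sD n (a - eb s.1) (b - eb s.2) (k - if a - eb s.1 = b - eb s.2 then 1 else 0) := by
  ext p
  simp only [sD, Set.mem_ofPred_eq, List.map_append, List.map_singleton, nonneg_snoc,
    List.length_append, List.length_singleton]
  by_cases hn : p.length = n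
  · have hl : (p.map Prod.fst).length = n := by simpa using hn
    have hr : (p.map Prod.snd).length = n := by simpa using hn
    rw [meet_snoc n _ _ _ _ hl hr, ht_gt _ _ _ (by omega), ht_gt _ _ _ (by omega), hl, hr]
    constructor
    · rintro ⟨-, ⟨h1, h2⟩, ⟨h3, h4⟩, h5, h6, h7⟩
      refine ⟨hn, h1, h3, by omega, by omega, ?_⟩
      rw [← h5, ← h6, ← h7]
      simp
    · rintro ⟨-, h1, h3, h5, h6, h7⟩
      refine ⟨by omega, ⟨h1, by omega⟩, ⟨h3, by omega⟩, by omega, by omega, ?_⟩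
      rw [h5, h6]
      push_cast
      omega
  · constructor
    · rintro ⟨h, -⟩
      omega
    · rintro ⟨h, -⟩
      omega

lemma cD_succ (n : ℕ) (a b k : ℤ) (ha : 0 ≤ a) (hb : 0 ≤ b) :
    cD (n + 1) a b k =
      cD n (a - 1) (b - 1) (k - if a = b then 1 else 0)
      + cD n (a - 1) (b + 1) (k - if a = b + 2 then 1 else 0)
      + cD n (a + 1) (b - 1) (k - if a + 2 = b then 1 else 0)
      + cD n (a + 1) (b + 1) (k - if a = b then 1 else 0) := by
  conv_lhs => unfold cD
  rw [ncard_snoc n _ (fun w hw => hw.1)]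
  simp only [sD_snoc n a b k ha hb]
  rw [Fintype.sum_prod_type]
  have h1 : a - 1 = b + 1 ↔ a = b + 2 := by omega
  have h2 : a + 1 = b - 1 ↔ a + 2 = b := by omega
  simp [eb, cD, h1, h2]
  ring

lemma cD_symm (n : ℕ) : ∀ a b k : ℤ, cD n a b k = cD n b a k := by
  induction n with
  | zero => intro a b k; rw [cD_zero, cD_zero]; congr 1; apply propext; tauto
  | succ n ih =>
    intro a b k
    by_cases h : a < 0 ∨ b < 0
    · rw [cD_neg _ _ _ _ h, cD_neg _ _ _ _ h.symm]
    · rw [cD_succ _ _ _ _ (by omega) (by omega), cD_succ _ _ _ _ (by omega) (by omega),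
        ih (a - 1) (b - 1), ih (a - 1) (b + 1), ih (a + 1) (b - 1), ih (a + 1) (b + 1)]
      have h1 : b = a + 2 ↔ a + 2 = b := by omega
      have h2 : b + 2 = a ↔ a = b + 2 := by omega
      have h3 : b = a ↔ a = b := by omega
      simp only [h1, h2, h3]
      ring

lemma cC_eq_cD (n : ℕ) : ∀ x y k : ℤ, 0 ≤ y →
    cC n x y k = if y = 0 then cD n x x k else 2 * cD n x (x + 2 * y) k := by
  induction n with
  | zero =>
    intro x y k hy
    rw [cC_zero, cD_zero, cD_zero]
    split_ifs <;> omega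
  | succ n ih =>
    intro x y k hy
    by_cases hx : x < 0
    · rw [cC_neg _ _ _ _ (Or.inl hx), cD_neg _ _ _ _ (Or.inl hx), cD_neg _ _ _ _ (Or.inl hx)]
      simp
    push Not at hx
    rw [cC_succ _ _ _ _ hx hy]
    by_cases h0 : y = 0
    · subst h0
      rw [cD_succ _ _ _ _ hx hx, cC_neg n (x+1) (0 - 1) _ (by omega), ih _ _ _ le_rfl,
        ih _ _ _ le_rfl, ih (x - 1) (0 + 1) _ (by omega), cD_symm n (x+1) (x-1)]
      simp
      rw [show x - 1 + 2 = x + 1 by ring]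
      ring
    · have hy1 : 1 ≤ y := by omega
      rw [cD_succ _ x _ _ hx (by omega : 0 ≤ x + 2 * y), ih _ _ _ hy, ih _ _ _ hy, ih _ (y - 1) _ (by omega),
        ih (x - 1) (y + 1) _ (by omega), ih _ 0 _ le_rfl]
      have n1 : ¬ (x = x + 2 * y) := by omega
      have n2 : ¬ (x = x + 2 * y + 2) := by omega
      have n3 : x + 2 = x + 2 * y ↔ y = 1 := by omega
      have n4 : y - 1 = 0 ↔ y = 1 := by omega
      have n5 : ¬ (y + 1 = 0) := by omega
      simp only [h0, n1, n2, n3, n4, n5, if_false, if_true, sub_zero]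
      rw [show x - 1 + 2 * y = x + 2 * y - 1 by ring, show x + 1 + 2 * y = x + 2 * y + 1 by ring,
        show x + 1 + 2 * (y - 1) = x + 2 * y - 1 by ring,
        show x - 1 + 2 * (y + 1) = x + 2 * y + 1 by ring]
      by_cases h1 : y = 1
      · subst h1
        simp only [if_true]
        rw [show x + 2 * 1 - 1 = x + 1 by ring]
        ring
      · simp only [h1, if_false]
        ring

/-- The power series attached to an integer-indexed family. -/
noncomputable def serS (f : ℤ → ℤ → ℤ → ℤ → ℤ) : MvPowerSeries (Fin 4) ℤ :=
  fun d => f (d 0) (d 1) (d 2) (d 3)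

/-- Support in the nonnegative orthant. -/
def NNs (f : ℤ → ℤ → ℤ → ℤ → ℤ) : Prop :=
  ∀ a b c d, (a < 0 ∨ b < 0 ∨ c < 0 ∨ d < 0) → f a b c d = 0

lemma coeff_mono_mul (p q r s : ℕ) (f : ℤ → ℤ → ℤ → ℤ → ℤ) (hf : NNs f) (d : Fin 4 →₀ ℕ) :
    MvPowerSeries.coeff d (MvPowerSeries.X 0 ^ p * MvPowerSeries.X 1 ^ q * MvPowerSeries.X 2 ^ r *
      MvPowerSeries.X 3 ^ s * serS f) = f (d 0 - p) (d 1 - q) (d 2 - r) (d 3 - s) := by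
  have e : (MvPowerSeries.X 0 ^ p * MvPowerSeries.X 1 ^ q * MvPowerSeries.X 2 ^ r *
      MvPowerSeries.X 3 ^ s : MvPowerSeries (Fin 4) ℤ) =
      MvPowerSeries.monomial (Finsupp.single 0 p + Finsupp.single 1 q + Finsupp.single 2 r
        + Finsupp.single 3 s) 1 := by
    simp [MvPowerSeries.X_pow_eq, MvPowerSeries.monomial_mul_monomial]
  rw [e, MvPowerSeries.coeff_monomial_mul]
  split_ifs with h
  · have h0 := h 0
    have h1 := h 1
    have h2 := h 2
    have h3 := h 3
    simp at h0 h1 h2 h3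
    change 1 * f _ _ _ _ = _
    simp [Nat.cast_sub h0, Nat.cast_sub h1, Nat.cast_sub h2, Nat.cast_sub h3]
  · symm
    apply hf
    by_contra hc
    push Not at hc
    apply h
    intro i
    fin_cases i <;> simp <;> omega

/-- `Ř` coefficients. -/
noncomputable def fF (a b k n : ℤ) : ℤ := if n < 0 then 0 else cC n.toNat a b k
/-- `Ř^y` coefficients. -/
noncomputable def fFy (a b k n : ℤ) : ℤ := if a = 0 then fF 0 b k n else 0
/-- `Ř^x` coefficients. -/
noncomputable def fFx (a b k n : ℤ) : ℤ := if b = 0 then fF a 0 k n else 0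
/-- `Ř^0` coefficients. -/
noncomputable def fF0 (a b k n : ℤ) : ℤ := if a = 0 ∧ b = 0 then fF 0 0 k n else 0
/-- Coefficients of `1`. -/
noncomputable def fF1 (a b k n : ℤ) : ℤ := if a = 0 ∧ b = 0 ∧ k = 0 ∧ n = 0 then 1 else 0

lemma fF_NN : NNs fF := by
  intro a b c d h
  unfold fF
  split_ifs with hd
  · rfl
  · rw [cC_neg _ _ _ _ (by omega)]; rfl
lemma fFy_NN : NNs fFy := by
  intro a b c d h
  unfold fFy
  split_ifs with hd
  · exact fF_NN _ _ _ _ (by omega)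
  · rfl
lemma fFx_NN : NNs fFx := by
  intro a b c d h
  unfold fFx
  split_ifs with hd
  · exact fF_NN _ _ _ _ (by omega)
  · rfl
lemma fF0_NN : NNs fF0 := by
  intro a b c d h
  unfold fF0
  split_ifs with hd
  · exact fF_NN _ _ _ _ (by omega)
  · rfl
lemma fF1_NN : NNs fF1 := by
  intro a b c d h
  unfold fF1
  rw [if_neg (by omega)]

lemma Rv_eq : Rv = serS fF := by
  funext d
  simp only [Rv, serS, fF, rv_eq]
  rw [if_neg (by omega), Int.toNat_natCast]
lemma Rvy_eq : Rvy = serS fFy := by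
  funext d
  simp only [Rvy, serS, fFy, fF, rv_eq]
  rw [if_neg (by omega : ¬ ((d 3 : ℕ) : ℤ) < 0), Int.toNat_natCast]
  simp
lemma Rvx_eq : Rvx = serS fFx := by
  funext d
  simp only [Rvx, serS, fFx, fF, rv_eq]
  rw [if_neg (by omega : ¬ ((d 3 : ℕ) : ℤ) < 0), Int.toNat_natCast]
  simp
lemma Rv0_eq : Rv0 = serS fF0 := by
  funext d
  simp only [Rv0, serS, fF0, fF, rv_eq]
  rw [if_neg (by omega : ¬ ((d 3 : ℕ) : ℤ) < 0), Int.toNat_natCast]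
  simp
lemma one_eq_serS : (1 : MvPowerSeries (Fin 4) ℤ) = serS fF1 := by
  ext d
  rw [MvPowerSeries.coeff_one]
  change _ = fF1 _ _ _ _
  unfold fF1
  have : d = 0 ↔ ((d 0 : ℕ) : ℤ) = 0 ∧ ((d 1 : ℕ) : ℤ) = 0 ∧ ((d 2 : ℕ) : ℤ) = 0 ∧
      ((d 3 : ℕ) : ℤ) = 0 := by
    constructor
    · rintro rfl; simp
    · rintro ⟨h0, h1, h2, h3⟩
      ext i
      fin_cases i <;> simp <;> omega
  simp only [this]

lemma fF_succ (a b k : ℤ) (n : ℕ) : fF a b k ((n + 1 : ℕ) - 1) = cC n a b k := by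
  unfold fF
  rw [if_neg (by push_cast; omega)]
  congr 2
  push_cast; omega

/-- The coefficientwise form of the functional equation. -/
lemma pointwise (a b k n : ℕ) :
    fF (a - 1) (b - 1) k n - fF a (b - 1) k (n - 1) - fF a (b - 2) k (n - 1)
      - fF (a - 2) b k (n - 1) - fF (a - 2) (b - 1) k (n - 1) =
    fF1 (a - 1) (b - 1) k n - fFy a (b - 1) k (n - 1) - fFy a (b - 2) k (n - 1)
      + fFx a (b - 2) k (n - 1) - fFx (a - 2) b k (n - 1)
      + fFx (a - 2) (b - 1) (k - 1) (n - 1) + fFx a (b - 1) (k - 1) (n - 1)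
      + 2 * fFx a (b - 2) (k - 1) (n - 1)
      - fFx (a - 2) (b - 1) k (n - 1) - fFx a (b - 1) k (n - 1)
      - 2 * fFx a (b - 2) k (n - 1)
      - fF0 a (b - 2) k (n - 1) - fF0 a (b - 1) (k - 1) (n - 1)
      - 2 * fF0 a (b - 2) (k - 1) (n - 1) + fF0 a (b - 1) k (n - 1)
      + 2 * fF0 a (b - 2) k (n - 1) := by
  rcases n with _ | n
  · have z : ∀ a b k : ℤ, fF a b k ((0 : ℕ) - 1) = 0 := fun a b k => fF_NN _ _ _ _ (by simp)
    simp only [fFy, fFx, fF0, z, ite_self]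
    simp [fF, fF1, cC_zero]
  · simp only [fFy, fFx, fF0, fF_succ]
    have h1 : fF1 (a - 1) (b - 1) k ((n + 1 : ℕ)) = 0 := by
      unfold fF1
      rw [if_neg (by push_cast; omega)]
    have h2 : fF (a - 1) (b - 1) k ((n + 1 : ℕ)) = cC (n + 1) (a - 1) (b - 1) k := by
      unfold fF
      rw [if_neg (by push_cast; omega)]; rfl
    rw [h1, h2]
    have neg : ∀ i j k : ℤ, i < 0 ∨ j < 0 → cC n i j k = 0 := fun i j k h =>
      cC_neg _ _ _ _ (by omega)
    by_cases hb : b = 0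
    · subst hb
      rw [cC_neg (n + 1) _ _ _ (by simp)]
      by_cases ha : a = 2
      · subst ha; simp [neg]
      · simp [neg]
    obtain ⟨b, rfl⟩ := Nat.exists_eq_add_of_le' (Nat.one_le_iff_ne_zero.2 hb)
    by_cases ha : a = 0
    · subst ha
      rw [cC_neg (n + 1) _ _ _ (by simp)]
      simp [neg]
      split_ifs <;> simp_all <;> omega
    obtain ⟨a, rfl⟩ := Nat.exists_eq_add_of_le' (Nat.one_le_iff_ne_zero.2 ha)
    rw [cC_succ _ _ _ _ (by push_cast; omega) (by push_cast; omega)]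
    have e1 : ((a + 1 : ℕ) : ℤ) - 1 = a := by push_cast; ring
    have e2 : ((b + 1 : ℕ) : ℤ) - 1 = b := by push_cast; ring
    have e3 : ((a + 1 : ℕ) : ℤ) - 2 = a - 1 := by push_cast; ring
    have e4 : ((b + 1 : ℕ) : ℤ) - 2 = b - 1 := by push_cast; ring
    have e5 : ((a + 1 : ℕ) : ℤ) ≠ 0 := by push_cast; omega
    have e6 : ((b + 1 : ℕ) : ℤ) ≠ 0 := by push_cast; omega
    have e7 : (b : ℤ) - 1 = 0 ↔ (b : ℤ) = 1 := by omega
    simp only [e1, e2, e3, e4, e5, e6, e7, if_false, false_and]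
    push_cast
    by_cases hb0 : (b : ℤ) = 0
    · simp [hb0, neg]
      ring
    · by_cases hb1 : (b : ℤ) = 1
      · simp [hb1]
        ring
      · simp only [hb0, hb1, if_false, sub_zero]
        ring

lemma functional_equation :
    (MvPowerSeries.X 0 * MvPowerSeries.X 1
        - MvPowerSeries.X 3 * (MvPowerSeries.X 1 + (MvPowerSeries.X 0) ^ 2)
          * (1 + MvPowerSeries.X 1)) * Rv
      = MvPowerSeries.X 0 * MvPowerSeries.X 1
        - MvPowerSeries.X 3 * MvPowerSeries.X 1 * (1 + MvPowerSeries.X 1) * Rvy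
        + MvPowerSeries.X 3 * ((MvPowerSeries.X 1) ^ 2 - (MvPowerSeries.X 0) ^ 2
            + (MvPowerSeries.X 2 - 1) * MvPowerSeries.X 1
              * ((MvPowerSeries.X 0) ^ 2 + 1 + 2 * MvPowerSeries.X 1)) * Rvx
        - MvPowerSeries.X 3 * MvPowerSeries.X 1
            * (MvPowerSeries.X 1 + (MvPowerSeries.X 2 - 1)
              * (1 + 2 * MvPowerSeries.X 1)) * Rv0 := by
  let mm : ℕ → ℕ → ℕ → ℕ → MvPowerSeries (Fin 4) ℤ := fun p q r s =>
    MvPowerSeries.X 0 ^ p * MvPowerSeries.X 1 ^ q * MvPowerSeries.X 2 ^ r * MvPowerSeries.X 3 ^ s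
  have key : mm 1 1 0 0 * Rv - mm 0 1 0 1 * Rv - mm 0 2 0 1 * Rv - mm 2 0 0 1 * Rv
      - mm 2 1 0 1 * Rv =
    mm 1 1 0 0 * 1 - mm 0 1 0 1 * Rvy - mm 0 2 0 1 * Rvy
      + mm 0 2 0 1 * Rvx - mm 2 0 0 1 * Rvx
      + mm 2 1 1 1 * Rvx + mm 0 1 1 1 * Rvx
      + (mm 0 2 1 1 * Rvx + mm 0 2 1 1 * Rvx)
      - mm 2 1 0 1 * Rvx - mm 0 1 0 1 * Rvx
      - (mm 0 2 0 1 * Rvx + mm 0 2 0 1 * Rvx)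
      - mm 0 2 0 1 * Rv0 - mm 0 1 1 1 * Rv0
      - (mm 0 2 1 1 * Rv0 + mm 0 2 1 1 * Rv0) + mm 0 1 0 1 * Rv0
      + (mm 0 2 0 1 * Rv0 + mm 0 2 0 1 * Rv0) := by
    ext d
    rw [Rv_eq, Rvy_eq, Rvx_eq, Rv0_eq, one_eq_serS]
    have c := fun p q r s => coeff_mono_mul p q r s fF fF_NN d
    have cx := fun p q r s => coeff_mono_mul p q r s fFx fFx_NN d
    have cy := fun p q r s => coeff_mono_mul p q r s fFy fFy_NN d
    have c0 := fun p q r s => coeff_mono_mul p q r s fF0 fF0_NN d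
    have c1 := fun p q r s => coeff_mono_mul p q r s fF1 fF1_NN d
    simp only [map_sub, map_add, mm, c, cx, cy, c0, c1]
    have := pointwise (d 0) (d 1) (d 2) (d 3)
    simp only [Nat.cast_zero, Nat.cast_one, Nat.cast_ofNat, sub_zero]
    linarith
  simp only [mm] at key
  linear_combination key

/-- Gluing a pair of paths of length `n` into a path of length `2n`. -/
def glue (p : List (Bool × Bool)) : List Bool :=
  p.map Prod.fst ++ ((p.map Prod.snd).reverse.map not)

lemma count_map_not (l : List Bool) (b : Bool) : (l.map not).count b = l.count (!b) := by
  induction l with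
  | nil => rfl
  | cons a t ih =>
    rw [List.map_cons, List.count_cons, List.count_cons, ih]
    cases a <;> cases b <;> rfl

lemma count_tf (l : List Bool) : l.count true + l.count false = l.length := by
  induction l with
  | nil => rfl
  | cons a t ih => cases a <;> simp <;> omega

lemma ht_glue_left (p : List (Bool × Bool)) (i : ℕ) (h : i ≤ p.length) :
    ht (glue p) i = ht (p.map Prod.fst) i := by
  unfold ht glue
  rw [List.take_append_of_le_length (by simpa using h)]

lemma ht_glue_right (p : List (Bool × Bool)) (i : ℕ) (h : i ≤ p.length) :
    ht (glue p) (2 * p.length - i) =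
      ht (p.map Prod.fst) p.length - ht (p.map Prod.snd) p.length + ht (p.map Prod.snd) i := by
  have h1 : (glue p).take (2 * p.length - i) =
      p.map Prod.fst ++ (((p.map Prod.snd).drop i).reverse.map not) := by
    unfold glue
    have : 2 * p.length - i = (p.map Prod.fst).length + (p.length - i) := by simp; omega
    rw [this, List.take_length_add_append, ← List.map_take, List.take_reverse]
    congr 4
    simp; omega
  have h2 : ∀ b, (p.map Prod.snd).count b =
      ((p.map Prod.snd).take i).count b + ((p.map Prod.snd).drop i).count b := fun b => by
    rw [← List.count_append, List.take_append_drop]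
  unfold ht
  rw [h1, List.take_of_length_le (l := p.map Prod.fst) (by simp),
    List.take_of_length_le (l := p.map Prod.snd) (by simp), h2 true, h2 false]
  simp only [List.count_append, count_map_not, List.count_reverse, Bool.not_true, Bool.not_false]
  push_cast
  ring

lemma length_glue (p : List (Bool × Bool)) : (glue p).length = 2 * p.length := by
  simp [glue]; omega

lemma count_glue (p : List (Bool × Bool)) : (glue p).count true = p.length ↔
    ht (p.map Prod.fst) p.length = ht (p.map Prod.snd) p.length := by
  have h1 := count_tf (p.map Prod.fst)
  have h2 := count_tf (p.map Prod.snd)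
  unfold ht
  rw [List.take_of_length_le (l := p.map Prod.fst) (by simp),
    List.take_of_length_le (l := p.map Prod.snd) (by simp)]
  unfold glue
  rw [List.count_append, count_map_not, List.count_reverse, Bool.not_true]
  rw [List.length_map] at h1 h2
  omega

lemma dyck_glue (n k : ℕ) (p : List (Bool × Bool)) (hp : p.length = n) :
    (IsDyck n (glue p) ∧ svGD n (glue p) = k) ↔ ∃ a, p ∈ sD n a a k := by
  subst hp
  have key : ht (p.map Prod.fst) p.length = ht (p.map Prod.snd) p.length →
      ((∀ j, 0 ≤ ht (glue p) j) ↔ (∀ j, 0 ≤ ht (p.map Prod.fst) j) ∧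
        (∀ j, 0 ≤ ht (p.map Prod.snd) j)) ∧
      svGD p.length (glue p) = meet p.length (p.map Prod.fst) (p.map Prod.snd) := by
    intro he
    have hr : ∀ i ≤ p.length, ht (glue p) (2 * p.length - i) = ht (p.map Prod.snd) i := by
      intro i hi
      rw [ht_glue_right p i hi, he]; ring
    refine ⟨⟨fun h => ⟨fun j => ?_, fun j => ?_⟩, ?_⟩, ?_⟩
    · rcases le_total j p.length with hj | hj
      · rw [← ht_glue_left p j hj]; exact h j
      · rw [ht_big _ j (by simpa using hj), List.length_map, ← ht_glue_left p _ le_rfl]; exact h _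
    · rcases le_total j p.length with hj | hj
      · rw [← hr j hj]; exact h _
      · rw [ht_big _ j (by simpa using hj), List.length_map, ← hr _ le_rfl]; exact h _
    · rintro ⟨h1, h2⟩ j
      rcases le_total j p.length with hj | hj
      · rw [ht_glue_left p j hj]; exact h1 j
      · rcases le_total j (2 * p.length) with hj2 | hj2
        · have := hr (2 * p.length - j) (by omega)
          rw [show 2 * p.length - (2 * p.length - j) = j by omega] at this
          rw [this]; exact h2 _
        · rw [ht_big _ j (by rwa [length_glue]), length_glue]
          have := hr 0 (by omega)
          rw [Nat.sub_zero] at this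
          rw [this]; exact h2 _
    · unfold svGD meet
      congr 1
      apply Finset.filter_congr
      intro i hi
      have := Finset.mem_range.1 hi
      rw [ht_glue_left p i this.le, hr i this.le]
  unfold IsDyck
  rw [count_glue, length_glue]
  constructor
  · rintro ⟨⟨-, he, h⟩, hk⟩
    obtain ⟨k1, k2⟩ := key he
    exact ⟨_, rfl, (k1.1 h).1, (k1.1 h).2, rfl, he.symm, by rw [← k2, hk]⟩
  · rintro ⟨a, -, h1, h2, h3, h4, h5⟩
    have he := h3.trans h4.symm
    obtain ⟨k1, k2⟩ := key he
    exact ⟨⟨rfl, he, k1.2 ⟨h1, h2⟩⟩, by rw [k2]; exact_mod_cast h5⟩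

lemma glue_inj (p q : List (Bool × Bool)) (h : p.length = q.length) (e : glue p = glue q) :
    p = q := by
  unfold glue at e
  obtain ⟨h1, h2⟩ := List.append_inj e (by simpa using h)
  have h3 : p.map Prod.snd = q.map Prod.snd := by
    have := (List.map_injective_iff.2 Bool.not_injective) h2
    exact List.reverse_injective this
  rw [← List.zip_unzip p, ← List.zip_unzip q, List.unzip_eq_map, List.unzip_eq_map]
  simp only [h1, h3]

lemma glue_surj (n : ℕ) (w : List Bool) (h : w.length = 2 * n) :
    ∃ p : List (Bool × Bool), p.length = n ∧ glue p = w := by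
  refine ⟨(w.take n).zip ((w.drop n).reverse.map not), by simp [h]; omega, ?_⟩
  unfold glue
  rw [List.map_fst_zip (by simp [h]; omega), List.map_snd_zip (by simp [h]; omega)]
  rw [← List.map_reverse, List.reverse_reverse, List.map_map]
  have : (not ∘ not) = id := by funext b; cases b <;> rfl
  rw [this, List.map_id, List.take_append_drop]

lemma cD_big (n : ℕ) : ∀ (a b k : ℤ), n < a → cD n a b k = 0 := by
  intro a b k h
  unfold cD
  convert Set.ncard_empty (List (Bool × Bool))
  ext p
  simp only [sD, Set.mem_ofPred_eq, Set.mem_empty_iff_false, iff_false]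
  rintro ⟨h0, -, -, h3, -, -⟩
  unfold ht at h3
  have := List.count_le_length (a := true) (l := (p.map Prod.fst).take n)
  simp at this
  omega

lemma dyck_count (n k : ℕ) :
    {w : List Bool | IsDyck n w ∧ svGD n w = k}.ncard = ∑ᶠ i, rv i 0 k n := by
  have e : ∀ i : ℕ, rv i 0 k n = cD n i i k := fun i => by
    rw [rv_eq, cC_eq_cD _ _ _ _ (by simp)]; simp
  simp only [e]
  rw [finsum_eq_sum_of_support_subset (s := Finset.range (n + 1)) _ (by
    intro i hi
    by_contra hc
    apply hi
    apply cD_big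
    simp at hc
    omega)]
  have fin : ∀ a : ℕ, (sD n a a k).Finite := fun a =>
    (List.finite_length_eq (Bool × Bool) n).subset (fun w hw => hw.1)
  have hS : {w : List Bool | IsDyck n w ∧ svGD n w = k} =
      Set.image glue (⋃ a ∈ Finset.range (n + 1), sD n (a : ℕ) (a : ℕ) k) := by
    ext w
    simp only [Set.mem_ofPred_eq, Set.mem_image, Set.mem_iUnion]
    constructor
    · intro h
      obtain ⟨p, hp, rfl⟩ := glue_surj n w h.1.1
      obtain ⟨a, ha⟩ := (dyck_glue n k p hp).1 h
      have h0 : 0 ≤ a := by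
        have := ha.2.1 n
        rwa [ha.2.2.2.1] at this
      lift a to ℕ using h0
      refine ⟨p, ⟨a, ?_, ha⟩, rfl⟩
      by_contra hc
      have h1 := cD_big n a a k (by simp at hc; omega)
      rw [cD, Set.ncard_eq_zero (fin a)] at h1
      rw [h1] at ha
      exact ha
    · rintro ⟨p, ⟨a, -, ha⟩, rfl⟩
      exact (dyck_glue n k p ha.1).2 ⟨a, ha⟩
  rw [hS, Set.InjOn.ncard_image]
  · have := Set.Finite.ncard_biUnion (Finset.finite_toSet (Finset.range (n + 1)))
      (s := fun a : ℕ => sD n a a k) (fun i _ => fin i) (by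
        intro a _ b _ hab
        rw [Function.onFun, Set.disjoint_left]
        intro p h1 h2
        apply hab
        have := h1.2.2.2.1.symm.trans h2.2.2.2.1
        exact_mod_cast this)
    rw [finsum_mem_coe_finset] at this
    exact this
  · intro p hp q hq
    simp only [Set.mem_iUnion] at hp hq
    obtain ⟨a, -, ha⟩ := hp
    obtain ⟨b, -, hb⟩ := hq
    exact glue_inj p q (ha.1.trans hb.1.symm)

/-- (1) The functional equation `(xy − z(y+x²)(1+y))·Ř = xy − zy(1+y)·Ř^y
+ z(y² − x² + (v−1)y(x²+1+2y))·Ř^x − zy(y + (v−1)(1+2y))·Ř^0` holds in `ℤ[[x,y,v,z]]`;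
and (2) the number of Dyck paths of semilength `n` with `k` symmetric vertices equals
`Σ_i ř(i,0,k,n)`. -/
theorem dyck_sv_functional_equation :
    (MvPowerSeries.X 0 * MvPowerSeries.X 1
        - MvPowerSeries.X 3 * (MvPowerSeries.X 1 + (MvPowerSeries.X 0) ^ 2)
          * (1 + MvPowerSeries.X 1)) * Rv
      = MvPowerSeries.X 0 * MvPowerSeries.X 1
        - MvPowerSeries.X 3 * MvPowerSeries.X 1 * (1 + MvPowerSeries.X 1) * Rvy
        + MvPowerSeries.X 3 * ((MvPowerSeries.X 1) ^ 2 - (MvPowerSeries.X 0) ^ 2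
            + (MvPowerSeries.X 2 - 1) * MvPowerSeries.X 1
              * ((MvPowerSeries.X 0) ^ 2 + 1 + 2 * MvPowerSeries.X 1)) * Rvx
        - MvPowerSeries.X 3 * MvPowerSeries.X 1
            * (MvPowerSeries.X 1 + (MvPowerSeries.X 2 - 1)
              * (1 + 2 * MvPowerSeries.X 1)) * Rv0 ∧
    ∀ n k : ℕ,
      {w : List Bool | IsDyck n w ∧ svGD n w = k}.ncard = ∑ᶠ i, rv i 0 k n := by
  exact ⟨functional_equation, dyck_count⟩
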